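/- Let a, b, d, e ∈ ℂ with Re(d+e−a−b−1) > 0, and assume none of d, e, b, d−a, b−e+1, d+e−a−1, d+e−b−1 is a nonpositive integer. Then for every n ∈ ℕ: [(b)_n (d−a)_n / ((d)_n (b−e+1)_n)] · ∑_{k=0}^∞ (a)_k (b+n)_k (1)_k / ((d+n)_k (e)_k · k!) = [Γ(d) Γ(e) Γ(b−e+1) Γ(d+e−a−b−1) / (Γ(b) Γ(d−a) Γ(d+e−b−1))] · [Γ(b+n) Γ(d−a+n) / (Γ(b−e+1+n) Γ(d+e−a−1+n))] · ∑_{k=0}^∞ (d+n−1)_k (d+e−a−b−1)_k (e−1)_k / ((d+e−a+n−1)_k (d+e−b−1)_k · k!), where both series converge absolutely. -/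

import Mathlib

open Complex

/-- Pochhammer symbol `(a)_k = a (a+1) ⋯ (a+k-1)`. -/
noncomputable def poch (a : ℂ) (k : ℕ) : ℂ := ∏ i ∈ Finset.range k, (a + i)

open Filter Topology Asymptotics Finset
open scoped Nat

lemma poch_zero (p : ℂ) : poch p 0 = 1 := by simp [poch]

lemma poch_succ (p : ℂ) (n : ℕ) : poch p (n + 1) = poch p n * (p + n) := by
  simp [poch, prod_range_succ]

lemma poch_one (n : ℕ) : poch 1 n = n ! := by
  induction n with
  | zero => simp [poch_zero]
  | succ n ih => rw [poch_succ, ih, Nat.factorial_succ]; push_cast; ring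

lemma poch_ne_zero {p : ℂ} (hp : ∀ m : ℕ, p ≠ -(m : ℂ)) (n : ℕ) : poch p n ≠ 0 :=
  prod_ne_zero_iff.2 fun i _ hi => hp i (eq_neg_of_add_eq_zero_left hi)

lemma add_natCast_ne_neg_natCast {p : ℂ} (hp : ∀ m : ℕ, p ≠ -(m : ℂ)) (n : ℕ) :
    ∀ m : ℕ, p + n ≠ -(m : ℂ) := by
  intro m hm
  apply hp (m + n)
  push_cast
  linear_combination hm

lemma ne_neg_natCast_of_re_pos {p : ℂ} (hp : 0 < p.re) : ∀ m : ℕ, p ≠ -(m : ℂ) := by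
  rintro m rfl
  have : (0 : ℝ) ≤ m := m.cast_nonneg
  simp at hp
  linarith

lemma Gamma_add_natCast {p : ℂ} (hp : ∀ m : ℕ, p ≠ -(m : ℂ)) (n : ℕ) :
    Gamma (p + n) = Gamma p * poch p n := by
  induction n with
  | zero => simp [poch_zero]
  | succ n ih =>
    have h0 : p + n ≠ 0 := by simpa using add_natCast_ne_neg_natCast hp n 0
    rw [Nat.cast_succ, ← add_assoc, Gamma_add_one _ h0, ih, poch_succ]
    ring

lemma tendsto_poch_div (p : ℂ) :
    Tendsto (fun n : ℕ => poch p n / (n ! * (n : ℂ) ^ (p - 1))) atTop (𝓝 (Gamma p)⁻¹) := by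
  by_cases hp : ∀ m : ℕ, p ≠ -(m : ℂ)
  · have h1 := ((GammaSeq_tendsto_Gamma p).inv₀ (Gamma_ne_zero hp)).mul
      (tendsto_natCast_div_add_atTop p)
    rw [mul_one] at h1
    refine h1.congr' ?_
    filter_upwards [eventually_ge_atTop 1] with n hn
    have hn0 : (n : ℂ) ≠ 0 := by exact_mod_cast (by omega : n ≠ 0)
    have hpn : (n : ℂ) + p ≠ 0 := by
      rw [add_comm]; simpa using add_natCast_ne_neg_natCast hp n 0
    have hf : (n ! : ℂ) ≠ 0 := by exact_mod_cast n.factorial_ne_zero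
    have hc : (n : ℂ) ^ p ≠ 0 := by simp [cpow_eq_zero_iff, hn0]
    have hG : GammaSeq p n = (n : ℂ) ^ p * n ! / (poch p n * (n + p)) := by
      rw [GammaSeq, prod_range_succ, add_comm p (n : ℂ), poch]
    rw [hG, cpow_sub _ _ hn0, cpow_one]
    field_simp
  · push Not at hp
    obtain ⟨m, rfl⟩ := hp
    rw [Gamma_neg_nat_eq_zero, inv_zero]
    refine tendsto_const_nhds.congr' ?_
    filter_upwards [eventually_gt_atTop m] with n hn
    have : poch (-(m : ℂ)) n = 0 := prod_eq_zero (mem_range.2 hn) (by simp)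
    simp [this]

lemma tendsto_factorial_mul_inv_Gamma_add (z : ℂ) :
    Tendsto (fun n : ℕ => n ! * (n : ℂ) ^ (z - 1) * (Gamma (z + n))⁻¹) atTop (𝓝 1) := by
  obtain ⟨N, hN⟩ := exists_nat_gt (-z.re)
  induction N generalizing z with
  | zero =>
    have hz : 0 < z.re := by simpa using hN
    have hG := Gamma_ne_zero_of_re_pos hz
    have h1 := ((tendsto_poch_div z).inv₀ (inv_ne_zero hG)).mul_const (Gamma z)⁻¹
    rw [inv_inv, mul_inv_cancel₀ hG] at h1
    refine h1.congr fun n => ?_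
    rw [Gamma_add_natCast (ne_neg_natCast_of_re_pos hz), inv_div, mul_inv]
    ring
  | succ N ih =>
    have h1 := (ih (z + 1) (by push_cast at hN; simp; linarith)).mul
      ((tendsto_natCast_div_add_atTop z).inv₀ one_ne_zero)
    rw [inv_one, mul_one] at h1
    refine h1.congr' ?_
    filter_upwards [eventually_ge_atTop 1] with n hn
    have hn0 : (n : ℂ) ≠ 0 := by exact_mod_cast (by omega : n ≠ 0)
    rw [one_div_Gamma_eq_self_mul_one_div_Gamma_add_one (z + n), add_sub_cancel_right,
      cpow_sub _ _ hn0, cpow_one, inv_div, add_right_comm]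
    field_simp
    ring

lemma isBigO_poch (p : ℂ) :
    poch p =O[atTop] fun n : ℕ => (n ! : ℝ) * (n : ℝ) ^ (p.re - 1) := by
  have h := (tendsto_poch_div p).isBigO_one ℂ
  have h2 := h.mul (isBigO_refl (fun n : ℕ => (n ! : ℂ) * (n : ℂ) ^ (p - 1)) atTop)
  refine (h2.congr' ?_ EventuallyEq.rfl).trans (IsBigO.of_norm_eventuallyLE ?_)
  · filter_upwards [eventually_ge_atTop 1] with n hn
    have hn0 : (n : ℂ) ≠ 0 := by exact_mod_cast (by omega : n ≠ 0)
    have hf : (n ! : ℂ) ≠ 0 := by exact_mod_cast n.factorial_ne_zero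
    exact div_mul_cancel₀ _ (mul_ne_zero hf (by simp [cpow_eq_zero_iff, hn0]))
  · filter_upwards [eventually_ge_atTop 1] with n hn
    simp [norm_natCast_cpow_of_pos hn]

lemma isBigO_inv_Gamma_add (z : ℂ) :
    (fun n : ℕ => (Gamma (z + n))⁻¹) =O[atTop]
      fun n : ℕ => ((n ! : ℝ))⁻¹ * (n : ℝ) ^ (1 - z.re) := by
  have h := (tendsto_factorial_mul_inv_Gamma_add z).isBigO_one ℂ
  have h2 := (isBigO_refl (fun n : ℕ => ((n ! : ℂ) * (n : ℂ) ^ (z - 1))⁻¹) atTop).mul h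
  refine (h2.congr' ?_ EventuallyEq.rfl).trans (IsBigO.of_norm_eventuallyLE ?_)
  · filter_upwards [eventually_ge_atTop 1] with n hn
    have hn0 : (n : ℂ) ≠ 0 := by exact_mod_cast (by omega : n ≠ 0)
    have hf : (n ! : ℂ) ≠ 0 := by exact_mod_cast n.factorial_ne_zero
    exact inv_mul_cancel_left₀ (mul_ne_zero hf (by simp [cpow_eq_zero_iff, hn0])) _
  · filter_upwards [eventually_ge_atTop 1] with n hn
    have hn0 : (0 : ℝ) ≤ n := n.cast_nonneg
    simp only [mul_one, norm_mul, norm_inv, norm_natCast_cpow_of_pos hn, norm_natCast, sub_re,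
      one_re]
    rw [mul_inv, ← Real.rpow_neg hn0, neg_sub]

lemma isBigO_inv_poch {p : ℂ} (hp : ∀ m : ℕ, p ≠ -(m : ℂ)) :
    (fun n : ℕ => (poch p n)⁻¹) =O[atTop]
      fun n : ℕ => ((n ! : ℝ))⁻¹ * (n : ℝ) ^ (1 - p.re) := by
  refine ((isBigO_inv_Gamma_add p).const_mul_left (Gamma p)).congr_left fun n => ?_
  rw [Gamma_add_natCast hp, mul_inv, mul_inv_cancel_left₀ (Gamma_ne_zero hp)]

/-- Absolute convergence of `₃F₂` at unit argument. -/
lemma summable_norm_poch_three {p q r u v : ℂ} (hu : ∀ m : ℕ, u ≠ -(m : ℂ))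
    (hv : ∀ m : ℕ, v ≠ -(m : ℂ)) (hre : 0 < (u + v - p - q - r).re) :
    Summable fun k : ℕ => ‖poch p k * poch q k * poch r k / (poch u k * poch v k * (k ! : ℂ))‖ := by
  have h := ((((isBigO_poch p).mul (isBigO_poch q)).mul (isBigO_poch r)).mul
    ((isBigO_inv_poch hu).mul (isBigO_inv_poch hv))).mul
    (isBigO_refl (fun n : ℕ => ((n ! : ℝ) : ℂ)⁻¹) atTop).norm_right
  refine Summable.norm (summable_of_isBigO_nat
    (g := fun n : ℕ => (n : ℝ) ^ (p.re + q.re + r.re - u.re - v.re - 1)) ?_ ?_)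
  · rw [Real.summable_nat_rpow]
    simp at hre
    linarith
  · refine (h.congr_left (fun n => ?_)).trans (EventuallyEq.isBigO ?_)
    · push_cast
      rw [div_eq_mul_inv, mul_inv, mul_inv]
      ring
    · filter_upwards [eventually_ge_atTop 1] with n hn
      have hn0 : (0 : ℝ) < n := by exact_mod_cast hn
      have hf : (n ! : ℝ) ≠ 0 := by exact_mod_cast n.factorial_ne_zero
      have hpow : (n : ℝ) ^ (p.re + q.re + r.re - u.re - v.re - 1) =
          n ^ (p.re - 1) * n ^ (q.re - 1) * n ^ (r.re - 1) * (n ^ (1 - u.re) * n ^ (1 - v.re)) := by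
        simp only [← Real.rpow_add hn0]
        congr 1
        ring
      rw [hpow, norm_inv, norm_real, Real.norm_natCast]
      field_simp

lemma isBigO_poch_mul_poch_mul_inv_Gamma (p q r : ℂ) :
    (fun k : ℕ => poch p k * poch q k / k ! * (Gamma (r + k))⁻¹) =O[atTop]
      fun k : ℕ => (k : ℝ) ^ (p.re + q.re - r.re - 1) := by
  have h := (((isBigO_poch p).mul (isBigO_poch q)).mul
    (isBigO_refl (fun n : ℕ => ((n ! : ℝ) : ℂ)⁻¹) atTop).norm_right).mul
    (isBigO_inv_Gamma_add r)
  refine (h.congr_left (fun n => ?_)).trans (EventuallyEq.isBigO ?_)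
  · push_cast
    rw [div_eq_mul_inv]
  · filter_upwards [eventually_ge_atTop 1] with n hn
    have hn0 : (0 : ℝ) < n := by exact_mod_cast hn
    have hf : (n ! : ℝ) ≠ 0 := by exact_mod_cast n.factorial_ne_zero
    have hpow : (n : ℝ) ^ (p.re + q.re - r.re - 1) =
        n ^ (p.re - 1) * n ^ (q.re - 1) * n ^ (1 - r.re) := by
      simp only [← Real.rpow_add hn0]
      congr 1
      ring
    rw [hpow, norm_inv, norm_real, Real.norm_natCast]
    field_simp

lemma summable_poch_mul_poch_mul_inv_Gamma {p q r : ℂ} (hre : 0 < (r - p - q).re) :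
    Summable fun k : ℕ => poch p k * poch q k / k ! * (Gamma (r + k))⁻¹ := by
  refine summable_of_isBigO_nat ?_ (isBigO_poch_mul_poch_mul_inv_Gamma p q r)
  rw [Real.summable_nat_rpow]
  simp at hre
  linarith

/-- The series `₂F₁(p, q; r; 1) / Γ(r)`. -/
noncomputable def regularizedGaussSum (p q r : ℂ) : ℂ :=
  ∑' k : ℕ, poch p k * poch q k / k ! * (Gamma (r + k))⁻¹

lemma regularizedGaussSum_add_one {p q r : ℂ} (hre : 0 < (r - p - q).re) :
    (r - p - q) * regularizedGaussSum p q r =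
      (r - p) * (r - q) * regularizedGaussSum p q (r + 1) := by
  set t : ℕ → ℂ := fun k => poch p k * poch q k / k ! * (Gamma (r + k))⁻¹ with ht
  set v : ℕ → ℂ := fun k => poch p k * poch q k / k ! * (Gamma (r + 1 + k))⁻¹ with hv
  have htv (k : ℕ) : t k = (r + k) * v k := by
    simp only [ht, hv]
    rw [one_div_Gamma_eq_self_mul_one_div_Gamma_add_one (r + k), add_right_comm]
    ring
  have hsucc (k : ℕ) : ((k + 1 : ℕ) : ℂ) * t (k + 1) = (p + k) * (q + k) * v k := by
    have hk : (k : ℂ) + 1 ≠ 0 := by exact_mod_cast k.succ_ne_zero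
    have hf : (k ! : ℂ) ≠ 0 := by exact_mod_cast k.factorial_ne_zero
    simp only [ht, hv, poch_succ, Nat.factorial_succ]
    push_cast
    rw [add_assoc r 1, add_comm (1 : ℂ) k]
    field_simp
  have hst : Summable t := summable_poch_mul_poch_mul_inv_Gamma hre
  have hsv : Summable v := summable_poch_mul_poch_mul_inv_Gamma (by simp at hre ⊢; linarith)
  have hlim : Tendsto (fun k : ℕ => (k : ℂ) * t k) atTop (𝓝 0) := by
    have h1 : (fun k : ℕ => (k : ℂ) * t k) =O[atTop] fun k : ℕ => (k : ℝ) ^ (-(r - p - q).re) := by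
      have h := (isBigO_refl (fun k : ℕ => (k : ℂ)) atTop).norm_right.mul
        (isBigO_poch_mul_poch_mul_inv_Gamma p q r)
      refine h.trans (EventuallyEq.isBigO ?_)
      filter_upwards [eventually_ge_atTop 1] with n hn
      have hn0 : (0 : ℝ) < n := by exact_mod_cast hn
      rw [norm_natCast, ← Real.rpow_one_add' hn0.le]
      · congr 1
        simp
        ring
      · simp at hre
        linarith
    exact h1.trans_tendsto ((tendsto_rpow_neg_atTop hre).comp tendsto_natCast_atTop_atTop)
  have hterm (k : ℕ) : (r - p - q) * t k - (r - p) * (r - q) * v k =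
      (k : ℂ) * t k - ((k + 1 : ℕ) : ℂ) * t (k + 1) := by
    rw [hsucc, htv]
    ring
  have hs := ((hst.mul_left (r - p - q)).sub (hsv.mul_left ((r - p) * (r - q)))).hasSum
  have h0 : Tendsto (fun n : ℕ => ∑ k ∈ range n,
      ((r - p - q) * t k - (r - p) * (r - q) * v k)) atTop (𝓝 0) := by
    simp only [hterm, sum_range_sub']
    simpa using hlim.neg
  have := tendsto_nhds_unique hs.tendsto_sum_nat h0
  rw [(hst.mul_left _).tsum_sub (hsv.mul_left _), tsum_mul_left, tsum_mul_left] at this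
  exact sub_eq_zero.1 this

lemma poch_mul_regularizedGaussSum {p q r : ℂ} (hre : 0 < (r - p - q).re) (n : ℕ) :
    poch (r - p - q) n * regularizedGaussSum p q r =
      poch (r - p) n * poch (r - q) n * regularizedGaussSum p q (r + n) := by
  induction n with
  | zero => simp [poch_zero]
  | succ n ih =>
    have hn : (0 : ℝ) ≤ n := n.cast_nonneg
    have h := regularizedGaussSum_add_one (p := p) (q := q) (r := r + n)
      (by simp at hre ⊢; linarith)
    rw [poch_succ, poch_succ, poch_succ, Nat.cast_succ, ← add_assoc]
    linear_combination (r - p - q + n) * ih + poch (r - p) n * poch (r - q) n * h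

lemma norm_poch_le_norm_poch {z w : ℂ} (hw : w.im = 0) (hw0 : 0 ≤ w.re) (h : w.re ≤ z.re) (n : ℕ) :
    ‖poch w n‖ ≤ ‖poch z n‖ := by
  rw [poch, poch, norm_prod, norm_prod]
  refine prod_le_prod (fun _ _ => norm_nonneg _) fun i _ => ?_
  have hi : (0 : ℝ) ≤ i := i.cast_nonneg
  have h1 : ‖w + i‖ = w.re + i := by
    have : w + i = ((w.re + i : ℝ) : ℂ) := Complex.ext (by simp) (by simp [hw])
    rw [this, norm_real, Real.norm_of_nonneg (by positivity)]
  rw [h1]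
  refine le_trans ?_ (re_le_norm _)
  simpa using h

lemma tendsto_inv_poch_add_natCast (r : ℂ) (k : ℕ) :
    Tendsto (fun n : ℕ => (poch (r + n) k)⁻¹) atTop (𝓝 (0 ^ k)) := by
  have h (i : ℕ) : Tendsto (fun n : ℕ => (r + n + i)⁻¹) atTop (𝓝 0) := by
    refine tendsto_inv₀_cobounded.comp ?_
    have := tendsto_natCast_atTop_cobounded (α := ℂ)
    have h2 := tendsto_add_const_cobounded (r + i) |>.comp this
    refine h2.congr fun n => ?_
    simp only [Function.comp]
    ring
  simpa [poch, prod_inv_distrib] using tendsto_finsetProd (range k) fun i _ => h i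

lemma tendsto_regularizedGaussSum {p q r : ℂ} (hre : 0 < (r - p - q).re) :
    Tendsto (fun n : ℕ => n ! * (n : ℂ) ^ (r - 1) * regularizedGaussSum p q (r + n))
      atTop (𝓝 1) := by
  obtain ⟨N, hN⟩ := exists_nat_gt (-r.re)
  set R : ℂ := ((r.re + N : ℝ) : ℂ) with hR
  have hRre : R.re = r.re + N := ofReal_re _
  have hR0 : 0 < R.re := by rw [hRre]; linarith
  have hN0 : (0 : ℝ) ≤ N := N.cast_nonneg
  have hsum : Summable fun k : ℕ => ‖poch p k * poch q k / (k ! : ℂ)‖ * (2 * ‖(poch R k)⁻¹‖) := by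
    have h := summable_poch_mul_poch_mul_inv_Gamma (p := p) (q := q) (r := R)
      (by simp at hre; simp [hRre]; linarith)
    refine (h.norm.mul_left (2 * ‖Gamma R‖)).congr fun k => ?_
    rw [Gamma_add_natCast (ne_neg_natCast_of_re_pos hR0), mul_inv, norm_mul, norm_mul, norm_inv]
    have := norm_ne_zero_iff.2 (Gamma_ne_zero_of_re_pos hR0)
    field_simp
  have hG := tendsto_factorial_mul_inv_Gamma_add r
  have hsplit : ∀ n ≥ N, ∀ k : ℕ, n ! * (n : ℂ) ^ (r - 1) *
      (poch p k * poch q k / k ! * (Gamma (r + n + k))⁻¹) =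
      poch p k * poch q k / k ! *
        (n ! * (n : ℂ) ^ (r - 1) * (Gamma (r + n))⁻¹ * (poch (r + n) k)⁻¹) := by
    intro n hn k
    have hn' : (N : ℝ) ≤ n := by exact_mod_cast hn
    rw [Gamma_add_natCast (p := r + n) (ne_neg_natCast_of_re_pos (by simp; linarith)), mul_inv]
    ring
  have key := tendsto_tsum_of_dominated_convergence (𝓕 := atTop)
    (f := fun (n k : ℕ) => n ! * (n : ℂ) ^ (r - 1) *
      (poch p k * poch q k / k ! * (Gamma (r + n + k))⁻¹))
    (g := fun k : ℕ => poch p k * poch q k / k ! * (1 * 0 ^ k)) hsum ?_ ?_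
  · have hone : ∑' k : ℕ, poch p k * poch q k / k ! * (1 * 0 ^ k) = 1 := by
      rw [tsum_eq_single 0 (fun k hk => by simp [hk])]
      simp [poch_zero]
    rw [hone] at key
    exact key.congr fun n => by rw [tsum_mul_left, regularizedGaussSum]
  · intro k
    refine Tendsto.congr' ?_ ((hG.mul (tendsto_inv_poch_add_natCast r k)).const_mul
      (poch p k * poch q k / k !))
    filter_upwards [eventually_ge_atTop N] with n hn
    exact (hsplit n hn k).symm
  · filter_upwards [eventually_ge_atTop N,
      hG.norm.eventually_le_const (u := 2) (by norm_num)] with n hn h2 k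
    have hn' : (N : ℝ) ≤ n := by exact_mod_cast hn
    rw [hsplit n hn k, norm_mul, norm_mul _ (poch (r + n) k)⁻¹]
    gcongr
    rw [norm_inv, norm_inv]
    refine inv_anti₀ (norm_pos_iff.2 (poch_ne_zero (ne_neg_natCast_of_re_pos hR0) k))
      (norm_poch_le_norm_poch (ofReal_im _) hR0.le ?_ k)
    simpa [hR] using hn'

/-- Gauss's summation theorem, in regularized form. -/
lemma regularizedGaussSum_eq {p q r : ℂ} (hre : 0 < (r - p - q).re) :
    regularizedGaussSum p q r = Gamma (r - p - q) * (Gamma (r - p))⁻¹ * (Gamma (r - q))⁻¹ := by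
  have hs := Gamma_ne_zero_of_re_pos hre
  have h := (((tendsto_poch_div (r - p)).mul (tendsto_poch_div (r - q))).mul
    ((tendsto_poch_div (r - p - q)).inv₀ (inv_ne_zero hs))).mul (tendsto_regularizedGaussSum hre)
  have h2 : Gamma (r - p - q) * (Gamma (r - p))⁻¹ * (Gamma (r - q))⁻¹ =
      (Gamma (r - p))⁻¹ * (Gamma (r - q))⁻¹ * (Gamma (r - p - q))⁻¹⁻¹ * 1 := by
    rw [inv_inv]
    ring
  rw [h2]
  refine tendsto_nhds_unique (tendsto_const_nhds.congr' ?_) h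
  filter_upwards [eventually_ge_atTop 1] with n hn
  have hn0 : (n : ℂ) ≠ 0 := by exact_mod_cast (by omega : n ≠ 0)
  have hf : (n ! : ℂ) ≠ 0 := by exact_mod_cast n.factorial_ne_zero
  have hc (z : ℂ) : (n : ℂ) ^ z ≠ 0 := by simp [cpow_eq_zero_iff, hn0]
  have hp := poch_ne_zero (ne_neg_natCast_of_re_pos hre) n
  have hpow : (n : ℂ) ^ (r - 1) * n ^ (r - p - q - 1) = n ^ (r - p - 1) * n ^ (r - q - 1) := by
    rw [← cpow_add _ _ hn0, ← cpow_add _ _ hn0]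
    congr 1
    ring
  have hrec := poch_mul_regularizedGaussSum hre n
  have h1 := hc (r - p - 1)
  have h3 := hc (r - q - 1)
  have h4 := hc (r - p - q - 1)
  rw [eq_comm, inv_div]
  calc _ = poch (r - p) n * poch (r - q) n * regularizedGaussSum p q (r + n) *
        ((n : ℂ) ^ (r - 1) * n ^ (r - p - q - 1)) /
        (poch (r - p - q) n * (n ^ (r - p - 1) * n ^ (r - q - 1))) := by field_simp
    _ = _ := by
      rw [← hrec, hpow]
      field_simp

lemma exists_forall_norm_le_of_isBigO {f : ℕ → ℂ} {g : ℕ → ℝ} (hg : ∀ n, 0 < g n) {x : ℝ}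
    (h : f =O[atTop] fun n : ℕ => g n * (n : ℝ) ^ x) :
    ∃ C : ℝ, 0 < C ∧ ∃ P : ℕ, ∀ n : ℕ, ‖f n‖ ≤ C * (g n * ((n : ℝ) + 1) ^ P) := by
  obtain ⟨P, hP⟩ := exists_nat_ge x
  have h2 : f =O[atTop] fun n : ℕ => g n * ((n : ℝ) + 1) ^ P := by
    refine h.trans (IsBigO.of_norm_eventuallyLE ?_)
    filter_upwards [eventually_ge_atTop 1] with n hn
    have hn1 : (1 : ℝ) ≤ n := by exact_mod_cast hn
    have hgn := hg n
    rw [Real.norm_of_nonneg (by positivity)]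
    gcongr
    calc (n : ℝ) ^ x ≤ (n : ℝ) ^ (P : ℝ) := Real.rpow_le_rpow_of_exponent_le hn1 hP
      _ = (n : ℝ) ^ P := Real.rpow_natCast _ _
      _ ≤ ((n : ℝ) + 1) ^ P := by gcongr; linarith
  obtain ⟨C, hC, hb⟩ := bound_of_isBigO_nat_atTop h2
  refine ⟨C, hC, P, fun n => ?_⟩
  have hgn := hg n
  have hpos : 0 < g n * ((n : ℝ) + 1) ^ P := by positivity
  simpa only [Real.norm_of_nonneg hpos.le] using hb (x := n) hpos.ne'

lemma add_one_pow_div_factorial_le_choose {K m : ℕ} (h : K ≤ m) (j : ℕ) :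
    ((j : ℝ) + 1) ^ K / K ! ≤ ((m + j).choose m : ℝ) := by
  have h1 := Nat.pow_le_choose (α := ℝ) K (K + j)
  rw [show K + j + 1 - K = j + 1 by omega] at h1
  push_cast at h1
  refine h1.trans ?_
  rw [Nat.choose_symm_add, Nat.choose_symm_add]
  exact_mod_cast Nat.choose_le_choose j (by omega)

lemma mul_pow_le_factorial_mul_choose {Q m j : ℕ} (hm : 2 * Q ≤ m) (hj : 2 * Q ≤ j) :
    (((m : ℝ) + 1) * (j + 1)) ^ Q ≤ (2 * Q)! * ((m + j).choose m : ℝ) := by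
  have h1 := add_one_pow_div_factorial_le_choose hm j
  have h2 := add_one_pow_div_factorial_le_choose hj m
  rw [add_comm j m, ← Nat.choose_symm_add] at h2
  have hf : (0 : ℝ) < (2 * Q)! := by exact_mod_cast Nat.factorial_pos _
  rw [div_le_iff₀' hf] at h1 h2
  refine (pow_le_pow_iff_left₀ (by positivity) (by positivity) two_ne_zero).1 ?_
  calc ((((m : ℝ) + 1) * (j + 1)) ^ Q) ^ 2 = (m + 1) ^ (2 * Q) * (j + 1) ^ (2 * Q) := by
        rw [← pow_mul, mul_comm Q, mul_pow]
    _ ≤ ((2 * Q)! * ((m + j).choose m : ℝ)) * ((2 * Q)! * ((m + j).choose m : ℝ)) := by gcongr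
    _ = _ := by ring

lemma summable_inv_add_one_sq : Summable fun n : ℕ => (((n : ℝ) + 1) ^ 2)⁻¹ := by
  have := (summable_nat_add_iff 1).2 (Real.summable_nat_pow_inv.2 one_lt_two)
  simpa using this

/-- A double series with summable rows and columns is summable as soon as its terms are bounded by
a polynomial divided by a binomial coefficient. -/
lemma summable_uncurry_of_le_div_choose {T : ℕ → ℕ → ℝ} (h0 : ∀ m j, 0 ≤ T m j)
    (hrow : ∀ m, Summable (T m)) (hcol : ∀ j, Summable fun m => T m j) {C : ℝ} {Q : ℕ}
    (hC : 0 ≤ C)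
    (hb : ∀ m j, T m j ≤ C * ((((m : ℝ) + 1) * (j + 1)) ^ Q / ((m + j).choose m : ℝ))) :
    Summable (Function.uncurry T) := by
  set K := 2 * (Q + 2) with hK
  set A : ℝ := C * K ! with hA
  have hlarge : ∀ m ≥ K, ∀ j ≥ K, T m j ≤ A * (((m : ℝ) + 1) ^ 2)⁻¹ * (((j : ℝ) + 1) ^ 2)⁻¹ := by
    intro m hm j hj
    have hch : (0 : ℝ) < (m + j).choose m := by exact_mod_cast Nat.choose_pos (by omega)
    have h1 := mul_pow_le_factorial_mul_choose hm hj
    refine (hb m j).trans ?_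
    rw [hA, mul_assoc, mul_assoc]
    gcongr
    rw [← mul_inv, ← mul_pow, ← div_eq_mul_inv, div_le_div_iff₀ hch (by positivity), ← pow_add]
    exact h1
  refine (summable_prod_of_nonneg (fun x => h0 x.1 x.2)).2 ⟨hrow, ?_⟩
  have hS := summable_inv_add_one_sq
  set S := ∑' j : ℕ, (((j : ℝ) + 1) ^ 2)⁻¹ with hSdef
  have hmaj : Summable fun m : ℕ =>
      ∑ j ∈ range K, T m j + A * (((m : ℝ) + 1) ^ 2)⁻¹ * S :=
    (summable_sum fun j _ => hcol j).add ((hS.mul_left A).mul_right S)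
  refine Summable.of_norm_bounded_eventually_nat hmaj ?_
  filter_upwards [eventually_ge_atTop K] with m hm
  rw [Real.norm_of_nonneg (tsum_nonneg (h0 m)), ← (hrow m).sum_add_tsum_nat_add K]
  gcongr
  have hSK := (summable_nat_add_iff K).2 hS
  calc ∑' j, T m (j + K)
      ≤ ∑' j : ℕ, A * (((m : ℝ) + 1) ^ 2)⁻¹ * ((((j + K : ℕ) : ℝ) + 1) ^ 2)⁻¹ :=
        Summable.tsum_le_tsum (fun j => hlarge m hm _ (by omega))
          ((summable_nat_add_iff K).2 (hrow m)) (hSK.mul_left _)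
    _ = A * (((m : ℝ) + 1) ^ 2)⁻¹ * ∑' j : ℕ, ((((j + K : ℕ) : ℝ) + 1) ^ 2)⁻¹ := tsum_mul_left
    _ ≤ A * (((m : ℝ) + 1) ^ 2)⁻¹ * S := by
        gcongr
        rw [hSdef, ← hS.sum_add_tsum_nat_add K]
        exact le_add_of_nonneg_left (sum_nonneg fun _ _ => by positivity)

lemma exists_norm_poch_mul_poch_div_factorial_le (p q : ℂ) :
    ∃ C : ℝ, 0 < C ∧ ∃ P : ℕ, ∀ n : ℕ,
      ‖poch p n * poch q n / (n ! : ℂ)‖ ≤ C * (n ! * ((n : ℝ) + 1) ^ P) := by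
  have h := isBigO_poch_mul_poch_mul_inv_Gamma p q 1
  obtain ⟨C, hC, P, hb⟩ := exists_forall_norm_le_of_isBigO (g := fun _ => 1)
    (fun _ => one_pos) (by simpa only [one_mul] using h)
  refine ⟨C, hC, P, fun n => ?_⟩
  have hf : (0 : ℝ) < n ! := by exact_mod_cast n.factorial_pos
  have h1 := hb n
  rw [add_comm (1 : ℂ), Gamma_nat_eq_factorial, norm_mul, norm_inv, norm_natCast, one_mul,
    ← div_eq_mul_inv, div_le_iff₀ hf] at h1
  linarith

lemma summable_poch_double {a b d e : ℂ} (hre : 0 < (d + e - a - b - 1).re) :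
    Summable (Function.uncurry fun m j : ℕ =>
      poch (d - 1) m * poch (e - 1) m / m ! * (poch a j * poch b j / j !) *
        (Gamma (d + e - 1 + m + j))⁻¹) := by
  obtain ⟨C₁, hC₁, P₁, h₁⟩ := exists_norm_poch_mul_poch_div_factorial_le (d - 1) (e - 1)
  obtain ⟨C₂, hC₂, P₂, h₂⟩ := exists_norm_poch_mul_poch_div_factorial_le a b
  obtain ⟨C₃, hC₃, P₃, h₃⟩ := exists_forall_norm_le_of_isBigO
    (fun n => by positivity) (isBigO_inv_Gamma_add (d + e - 1))
  refine Summable.of_norm (summable_uncurry_of_le_div_choose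
    (T := fun m j : ℕ => ‖poch (d - 1) m * poch (e - 1) m / m ! * (poch a j * poch b j / j !) *
        (Gamma (d + e - 1 + m + j))⁻¹‖) (C := C₁ * C₂ * C₃) (Q := P₁ + P₂ + P₃)
    (fun _ _ => norm_nonneg _) (fun m => ?_) (fun j => ?_) (by positivity) (fun m j => ?_))
  · have hm : (0 : ℝ) ≤ m := m.cast_nonneg
    have h := summable_poch_mul_poch_mul_inv_Gamma (p := a) (q := b) (r := d + e - 1 + m)
      (by simp at hre ⊢; linarith)
    refine (h.mul_left (poch (d - 1) m * poch (e - 1) m / m !)).norm.congr fun j => ?_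
    rw [mul_assoc]
  · have hj : (0 : ℝ) ≤ j := j.cast_nonneg
    have h := summable_poch_mul_poch_mul_inv_Gamma (p := d - 1) (q := e - 1) (r := d + e - 1 + j)
      (by simp; linarith)
    refine (h.mul_left (poch a j * poch b j / j !)).norm.congr fun m => ?_
    rw [add_right_comm _ (j : ℂ)]
    ring_nf
  · have h3 := h₃ (m + j)
    push_cast at h3
    rw [← add_assoc] at h3
    have hm : (0 : ℝ) ≤ m := m.cast_nonneg
    have hj : (0 : ℝ) ≤ j := j.cast_nonneg
    have hch : ((m + j).choose m : ℝ) * m ! * j ! = (m + j)! := by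
      rw [Nat.choose_symm_add]
      exact_mod_cast Nat.add_choose_mul_factorial_mul_factorial m j
    have hch0 : (0 : ℝ) < (m + j).choose m := by exact_mod_cast Nat.choose_pos (by omega)
    have hmf : (0 : ℝ) < m ! := by exact_mod_cast m.factorial_pos
    have hjf : (0 : ℝ) < j ! := by exact_mod_cast j.factorial_pos
    rw [norm_mul, norm_mul]
    calc _ ≤ (C₁ * (m ! * ((m : ℝ) + 1) ^ P₁)) * (C₂ * (j ! * ((j : ℝ) + 1) ^ P₂)) *
          (C₃ * (((m + j)! : ℝ)⁻¹ * ((m : ℝ) + j + 1) ^ P₃)) := by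
          gcongr
          exacts [h₁ m, h₂ j]
      _ ≤ (C₁ * (m ! * (((m : ℝ) + 1) * (j + 1)) ^ P₁)) *
          (C₂ * (j ! * (((m : ℝ) + 1) * (j + 1)) ^ P₂)) *
          (C₃ * (((m + j)! : ℝ)⁻¹ * (((m : ℝ) + 1) * (j + 1)) ^ P₃)) := by
          gcongr <;> nlinarith
      _ = _ := by
          rw [← hch]
          field_simp
          ring

/-- Thomae's transformation of a nonterminating `₃F₂` at unit argument with a numerator parameter
equal to one. -/
lemma tsum_poch_thomae {a b d e : ℂ} (hre : 0 < (d + e - a - b - 1).re)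
    (hd : ∀ m : ℕ, d ≠ -(m : ℂ)) (he : ∀ m : ℕ, e ≠ -(m : ℂ))
    (ha : ∀ m : ℕ, d + e - a - 1 ≠ -(m : ℂ)) (hb : ∀ m : ℕ, d + e - b - 1 ≠ -(m : ℂ)) :
    ∑' k : ℕ, poch a k * poch b k * poch 1 k / (poch d k * poch e k * (k ! : ℂ)) =
      Gamma d * Gamma e * Gamma (d + e - a - b - 1) /
        (Gamma (d + e - a - 1) * Gamma (d + e - b - 1)) *
      ∑' k : ℕ, poch (d - 1) k * poch (d + e - a - b - 1) k * poch (e - 1) k /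
        (poch (d + e - a - 1) k * poch (d + e - b - 1) k * (k ! : ℂ)) := by
  have hs := ne_neg_natCast_of_re_pos hre
  have hcomm := (summable_poch_double hre).tsum_comm
  have hfac (n : ℕ) : (n ! : ℂ) ≠ 0 := by exact_mod_cast n.factorial_ne_zero
  have hrow (m : ℕ) : ∑' j : ℕ, poch (d - 1) m * poch (e - 1) m / m ! *
      (poch a j * poch b j / j !) * (Gamma (d + e - 1 + m + j))⁻¹ =
      Gamma (d + e - a - b - 1) / (Gamma (d + e - a - 1) * Gamma (d + e - b - 1)) *
      (poch (d - 1) m * poch (d + e - a - b - 1) m * poch (e - 1) m /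
        (poch (d + e - a - 1) m * poch (d + e - b - 1) m * (m ! : ℂ))) := by
    have hm : (0 : ℝ) ≤ m := m.cast_nonneg
    have h := regularizedGaussSum_eq (p := a) (q := b) (r := d + e - 1 + m)
      (by simp at hre ⊢; linarith)
    rw [regularizedGaussSum, show d + e - 1 + m - a - b = d + e - a - b - 1 + m by ring,
      show d + e - 1 + m - a = d + e - a - 1 + m by ring,
      show d + e - 1 + m - b = d + e - b - 1 + m by ring,
      Gamma_add_natCast hs, Gamma_add_natCast ha, Gamma_add_natCast hb] at h
    simp only [mul_assoc, tsum_mul_left] at h ⊢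
    rw [h]
    simp only [div_eq_mul_inv, mul_inv]
    ring
  have hcol (j : ℕ) : ∑' m : ℕ, poch (d - 1) m * poch (e - 1) m / m ! *
      (poch a j * poch b j / j !) * (Gamma (d + e - 1 + m + j))⁻¹ =
      (Gamma d * Gamma e)⁻¹ *
        (poch a j * poch b j * poch 1 j / (poch d j * poch e j * (j ! : ℂ))) := by
    have hj : (0 : ℝ) ≤ j := j.cast_nonneg
    have h := regularizedGaussSum_eq (p := d - 1) (q := e - 1) (r := d + e - 1 + j)
      (by simp; linarith)
    rw [regularizedGaussSum, show d + e - 1 + j - (d - 1) - (e - 1) = j + 1 by ring,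
      show d + e - 1 + j - (d - 1) = e + j by ring,
      show d + e - 1 + j - (e - 1) = d + j by ring,
      Gamma_add_natCast hd, Gamma_add_natCast he, Gamma_nat_eq_factorial] at h
    calc _ = ∑' m : ℕ, poch a j * poch b j / j ! * (poch (d - 1) m * poch (e - 1) m / m ! *
          (Gamma (d + e - 1 + j + m))⁻¹) := by
          refine tsum_congr fun m => ?_
          rw [add_right_comm _ (j : ℂ)]
          ring
      _ = _ := by
          rw [tsum_mul_left, h, poch_one]
          simp only [div_eq_mul_inv, mul_inv]
          ring
  simp only [hrow, hcol, tsum_mul_left] at hcomm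
  have hG : Gamma d * Gamma e ≠ 0 := mul_ne_zero (Gamma_ne_zero hd) (Gamma_ne_zero he)
  rw [mul_div_assoc, mul_assoc, ← hcomm, mul_inv_cancel_left₀ hG]

theorem section5_transformation (a b d e : ℂ)
    (hre : 0 < (d + e - a - b - 1).re)
    (h : ∀ z ∈ [d, e, b, d - a, b - e + 1, d + e - a - 1, d + e - b - 1],
      ∀ m : ℕ, z ≠ -(m : ℂ)) :
    ∀ n : ℕ,
      (Summable fun k : ℕ =>
        ‖poch a k * poch (b + n) k * poch 1 k /
          (poch (d + n) k * poch e k * (Nat.factorial k : ℂ))‖) ∧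
      (Summable fun k : ℕ =>
        ‖poch (d + n - 1) k * poch (d + e - a - b - 1) k * poch (e - 1) k /
          (poch (d + e - a + n - 1) k * poch (d + e - b - 1) k * (Nat.factorial k : ℂ))‖) ∧
      poch b n * poch (d - a) n / (poch d n * poch (b - e + 1) n) *
          (∑' k : ℕ, poch a k * poch (b + n) k * poch 1 k /
            (poch (d + n) k * poch e k * (Nat.factorial k : ℂ))) =
        Complex.Gamma d * Complex.Gamma e * Complex.Gamma (b - e + 1) *
            Complex.Gamma (d + e - a - b - 1) /
          (Complex.Gamma b * Complex.Gamma (d - a) * Complex.Gamma (d + e - b - 1)) *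
        (Complex.Gamma (b + n) * Complex.Gamma (d - a + n) /
          (Complex.Gamma (b - e + 1 + n) * Complex.Gamma (d + e - a - 1 + n))) *
        (∑' k : ℕ, poch (d + n - 1) k * poch (d + e - a - b - 1) k * poch (e - 1) k /
          (poch (d + e - a + n - 1) k * poch (d + e - b - 1) k * (Nat.factorial k : ℂ))) := by
  intro n
  simp only [List.mem_cons, List.not_mem_nil, or_false, forall_eq_or_imp, forall_eq] at h
  obtain ⟨hd, he, hb, hda, hbe, hdea, hdeb⟩ := h
  have hdn := add_natCast_ne_neg_natCast hd n
  have hdean := add_natCast_ne_neg_natCast hdea n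
  have hs : d + n + e - a - (b + n) - 1 = d + e - a - b - 1 := by ring
  have hsa : d + e - a + n - 1 = d + e - a - 1 + n := by ring
  refine ⟨summable_norm_poch_three hdn he ?_, summable_norm_poch_three ?_ hdeb ?_, ?_⟩
  · convert hre using 2
  · rwa [hsa]
  · ring_nf
    exact one_pos
  · have hdeb' : d + n + e - (b + n) - 1 = d + e - b - 1 := by ring
    have hdea' : d + n + e - a - 1 = d + e - a - 1 + n := by ring
    have hT := tsum_poch_thomae (a := a) (b := b + n) (d := d + n) (e := e) (by rwa [hs]) hdn he
      (by rwa [hdea']) (by rwa [hdeb'])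
    have hterm : ∀ k : ℕ, poch (d + n - 1) k * poch (d + e - a - b - 1) k * poch (e - 1) k /
        (poch (d + e - a + n - 1) k * poch (d + e - b - 1) k * (Nat.factorial k : ℂ)) =
        poch (d + n - 1) k * poch (d + e - a - b - 1) k * poch (e - 1) k /
        (poch (d + e - a - 1 + n) k * poch (d + e - b - 1) k * (Nat.factorial k : ℂ)) := by
      intro k
      rw [hsa]
    rw [hs, hdea', hdeb'] at hT
    rw [hT, tsum_congr hterm, Gamma_add_natCast hd, Gamma_add_natCast hb, Gamma_add_natCast hda,
      Gamma_add_natCast hbe]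
    have h1 := Gamma_ne_zero hb
    have h2 := Gamma_ne_zero hda
    have h3 := Gamma_ne_zero hbe
    have h4 := Gamma_ne_zero hdeb
    have h5 := Gamma_ne_zero hdean
    have h6 := poch_ne_zero hd n
    have h7 := poch_ne_zero hbe n
    field_simp
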